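/- Fix δ ∈ (0,1) and η > 0. Under the identification and positivity assumption and the one-sided reward certificate assumption, with probability at least 1 − δ over the i.i.d. sample Z_1, …, Z_n, the inequality V*(d_Q) ≥ V̂_{R̲,n}(d_Q) − K_ε [ (KL(Q‖Π0) + log(1/δ))/(η n) + η/8 ] holds simultaneously for all posteriors Q ≪ Π0. Moreover, for fixed η the right-hand side of this bound is uniquely maximized over Q ≪ Π0 by the Gibbs posterior Q̂_η(dθ) ∝ exp( (η n / K_ε) · V̂_{R̲,n}(d_θ) ) Π0(dθ) = exp( −η Σ_{i=1}^n ℓ_val(θ; Z_i) ) Π0(dθ) (up to normalization). -/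

import Mathlib

open MeasureTheory ProbabilityTheory Real

/-- the certified lower reward `R̲ = (R − U(X,A,R))₊` -/
noncomputable def Rlow {Ω 𝒳 : Type*} (X : Ω → 𝒳) (A : Ω → ℤ) (R : Ω → ℝ)
    (U : 𝒳 → ℤ → ℝ → ℝ) (ω : Ω) : ℝ :=
  max (R ω - U (X ω) (A ω) (R ω)) 0

/-- the doubly robust score `Γ_a^α(Z)` -/
noncomputable def Gam {Ω 𝒳 𝒜 : Type*} (X : Ω → 𝒳) (A : Ω → ℤ) (pr : ℤ → 𝒳 → ℝ)
    (ν : ℤ → 𝒳 → 𝒜 → ℝ) (Rl : Ω → ℝ) (a : ℤ) (α : 𝒜) (ω : Ω) : ℝ :=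
  ν a (X ω) α + (if A ω = a then (1 : ℝ) else 0) / pr a (X ω) * (Rl ω - ν a (X ω) α)

/-- the empirical certified value `V̂_{R̲,n}(d_θ)` of `θ = (β,α)` on the sample `ωs`,
with `d_β = sgn(f_β)` and `sgn 0 = 1` -/
noncomputable def Vhat {Ω 𝒳 𝒜 ℬ : Type*} (X : Ω → 𝒳) (A : Ω → ℤ) (pr : ℤ → 𝒳 → ℝ)
    (ν : ℤ → 𝒳 → 𝒜 → ℝ) (Rl : Ω → ℝ) (f : 𝒳 → ℬ → ℝ) (n : ℕ)
    (θ : ℬ × 𝒜) (ωs : Fin n → Ω) : ℝ :=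
  (n : ℝ)⁻¹ * ∑ i, Gam X A pr ν Rl
    (if 0 ≤ f (X (ωs i)) θ.1 then 1 else -1) θ.2 (ωs i)

/-- `KL(Q‖Pri) = ∫ log(dQ/dPri) dQ` (as a real number, for `Q ≪ Pri` with integrable llr) -/
noncomputable def KLreal {Θ : Type*} [MeasurableSpace Θ] (Q Pri : Measure Θ) : ℝ :=
  ∫ θ, llr Q Pri θ ∂Q

open InformationTheory

/-- Pull-out property of the conditional expectation, integrated. -/
lemma integral_mul_condExp_of_bounded {Ω : Type*} {m mΩ : MeasurableSpace Ω} (hm : m ≤ mΩ)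
    {P : Measure Ω} [IsProbabilityMeasure P] {h F : Ω → ℝ} {C : ℝ}
    (hh : Measurable[m] h) (hhC : ∀ ω, |h ω| ≤ C) (hF : Integrable F P) :
    ∫ ω, h ω * (P[F | m]) ω ∂P = ∫ ω, h ω * F ω ∂P := by
  have hi : Integrable (h * F) P :=
    hF.bdd_mul (hh.mono hm le_rfl).aestronglyMeasurable (Filter.Eventually.of_forall hhC)
  rw [← integral_condExp hm (f := fun ω => h ω * F ω)]
  exact integral_congr_ae
    (condExp_mul_of_stronglyMeasurable_left hh.stronglyMeasurable hi hF).symm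

/-- Inverse propensity weighting: if `Y` and `A` are conditionally independent given `m`, `π` is the
conditional probability of `A = a`, and `h π = g`, then `E[h 1{A = a} Y] = E[g Y]`. -/
lemma integral_weight_mul_indicator_mul {Ω : Type*} {m mΩ : MeasurableSpace Ω}
    [StandardBorelSpace Ω] (hm : m ≤ mΩ) {P : Measure Ω} [IsProbabilityMeasure P]
    {Y : Ω → ℝ} {A : Ω → ℤ} (hY : Measurable Y) (hA : Measurable A)
    (hYA : CondIndepFun m hm Y A P) {a : ℤ} {p h g : Ω → ℝ} {C : ℝ}
    (hp : P[(fun ω => if A ω = a then (1 : ℝ) else 0) | m] =ᵐ[P] p)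
    (hh : Measurable[m] h) (hh0 : ∀ ω, 0 ≤ h ω) (hhC : ∀ ω, h ω ≤ C)
    (hg : Measurable[m] g) (hg0 : ∀ ω, 0 ≤ g ω) (hg1 : ∀ ω, g ω ≤ 1)
    (hhg : ∀ ω, h ω * p ω = g ω) :
    ∫ ω, h ω * (if A ω = a then (1 : ℝ) else 0) * Y ω ∂P = ∫ ω, g ω * Y ω ∂P := by
  have hhm : Measurable h := hh.mono hm le_rfl
  have hgm : Measurable g := hg.mono hm le_rfl
  have hAa : MeasurableSet {ω | A ω = a} := hA (measurableSet_singleton a)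
  set k : Ω → ℝ := fun ω => h ω * (if A ω = a then (1 : ℝ) else 0) with hk
  have hkm : Measurable k := hhm.mul (Measurable.ite hAa measurable_const measurable_const)
  have hk0 : ∀ ω, 0 ≤ k ω := fun ω => mul_nonneg (hh0 ω) (by split_ifs <;> norm_num)
  have hkC : ∀ ω, k ω ≤ C := fun ω => by
    have := hh0 ω
    have := hhC ω
    simp only [hk]
    split_ifs <;> linarith
  have hki : Integrable k P := Integrable.of_bound hkm.aestronglyMeasurable C
    (Filter.Eventually.of_forall fun ω => by rw [norm_of_nonneg (hk0 ω)]; exact hkC ω)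
  have hgi : Integrable g P := Integrable.of_bound hgm.aestronglyMeasurable 1
    (Filter.Eventually.of_forall fun ω => by rw [norm_of_nonneg (hg0 ω)]; exact hg1 ω)
  have hset : ∀ S : Set ℝ, MeasurableSet S → ∫ ω in Y ⁻¹' S, k ω ∂P = ∫ ω in Y ⁻¹' S, g ω ∂P := by
    intro S hS
    have hYS : MeasurableSet (Y ⁻¹' S) := hY hS
    have hAt : MeasurableSet (A ⁻¹' {a}) := hAa
    have hci := (condIndepFun_iff_condExp_inter_preimage_eq_mul hY hA).1 hYA S {a} hS
      (measurableSet_singleton a)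
    have hind : ((A ⁻¹' {a}).indicator fun _ => (1 : ℝ)) = fun ω => if A ω = a then (1 : ℝ) else 0 := by
      ext ω
      by_cases h2 : A ω = a <;> simp [h2]
    rw [hind] at hci
    have hint : ∀ T : Set Ω, MeasurableSet T → Integrable (T.indicator fun _ => (1 : ℝ)) P :=
      fun T hT => (integrable_const 1).indicator hT
    calc ∫ ω in Y ⁻¹' S, k ω ∂P
        = ∫ ω, h ω * ((Y ⁻¹' S ∩ A ⁻¹' {a}).indicator fun _ => (1 : ℝ)) ω ∂P := by
          rw [← integral_indicator hYS]
          congr 1 with ω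
          by_cases h1 : Y ω ∈ S <;> by_cases h2 : A ω = a <;> simp [hk, h1, h2]
      _ = ∫ ω, h ω * (P[(Y ⁻¹' S ∩ A ⁻¹' {a}).indicator fun _ => (1 : ℝ) | m]) ω ∂P :=
          (integral_mul_condExp_of_bounded hm hh
            (fun ω => by rw [abs_of_nonneg (hh0 ω)]; exact hhC ω) (hint _ (hYS.inter hAt))).symm
      _ = ∫ ω, g ω * (P[(Y ⁻¹' S).indicator fun _ => (1 : ℝ) | m]) ω ∂P := by
          refine integral_congr_ae ?_
          filter_upwards [hci, hp] with ω h1 h2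
          rw [h1, h2, ← hhg]
          ring
      _ = ∫ ω, g ω * ((Y ⁻¹' S).indicator fun _ => (1 : ℝ)) ω ∂P :=
          integral_mul_condExp_of_bounded hm hg
            (fun ω => by rw [abs_of_nonneg (hg0 ω)]; exact hg1 ω) (hint _ hYS)
      _ = ∫ ω in Y ⁻¹' S, g ω ∂P := by
          rw [← integral_indicator hYS]
          congr 1 with ω
          by_cases h1 : Y ω ∈ S <;> simp [h1]
  have hmap : (P.withDensity fun ω => ENNReal.ofReal (k ω)).map Y
      = (P.withDensity fun ω => ENNReal.ofReal (g ω)).map Y := by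
    ext S hS
    rw [Measure.map_apply hY hS, Measure.map_apply hY hS, withDensity_apply _ (hY hS),
      withDensity_apply _ (hY hS),
      ← ofReal_integral_eq_lintegral_ofReal hki.integrableOn (Filter.Eventually.of_forall hk0),
      ← ofReal_integral_eq_lintegral_ofReal hgi.integrableOn (Filter.Eventually.of_forall hg0),
      hset S hS]
  have hwd : ∀ q : Ω → ℝ, Measurable q → (∀ ω, 0 ≤ q ω) →
      ∫ y, y ∂((P.withDensity fun ω => ENNReal.ofReal (q ω)).map Y) = ∫ ω, q ω * Y ω ∂P := by
    intro q hq hq0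
    rw [integral_map hY.aemeasurable measurable_id'.aestronglyMeasurable,
      integral_withDensity_eq_integral_toReal_smul hq.ennreal_ofReal
        (Filter.Eventually.of_forall fun _ => ENNReal.ofReal_lt_top)]
    simp [ENNReal.toReal_ofReal, hq0]
  rw [← hwd g hgm hg0, ← hmap, hwd k hkm hk0]

/-- The doubly robust score takes values in `[1 - ε⁻¹, ε⁻¹]`. -/
lemma Gam_mem_Icc {Ω 𝒳 𝒜 : Type*} {X : Ω → 𝒳} {A : Ω → ℤ} {pr : ℤ → 𝒳 → ℝ}
    {ν : ℤ → 𝒳 → 𝒜 → ℝ} {Rl : Ω → ℝ} {a : ℤ} {α : 𝒜} {ω : Ω} {ε : ℝ}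
    (hε : ε ∈ Set.Ioc (0 : ℝ) (1 / 2)) (hpr : ε ≤ pr a (X ω))
    (hν : ν a (X ω) α ∈ Set.Icc (0 : ℝ) 1) (hRl : Rl ω ∈ Set.Icc (0 : ℝ) 1) :
    Gam X A pr ν Rl a α ω ∈ Set.Icc (1 - ε⁻¹) ε⁻¹ := by
  obtain ⟨hν0, hν1⟩ := hν
  obtain ⟨hR0, hR1⟩ := hRl
  have h1 : 1 ≤ ε⁻¹ := (one_le_inv₀ hε.1).2 (by linarith [hε.2])
  have ht : (pr a (X ω))⁻¹ ≤ ε⁻¹ := inv_anti₀ hε.1 hpr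
  have ht0 : 0 ≤ (pr a (X ω))⁻¹ := inv_nonneg.2 (hε.1.le.trans hpr)
  unfold Gam
  set t := (pr a (X ω))⁻¹
  set v := ν a (X ω) α
  set r := Rl ω
  split_ifs with hA
  · rw [one_div]
    constructor
    · rcases le_total t 1 with h | h <;> nlinarith [mul_nonneg ht0 hR0]
    · rcases le_total t 1 with h | h <;> nlinarith [mul_nonneg ht0 hR0]
  · rw [zero_div, zero_mul, add_zero]
    constructor <;> linarith

lemma Rlow_mem_Icc {Ω 𝒳 : Type*} {X : Ω → 𝒳} {A : Ω → ℤ} {R : Ω → ℝ} {U : 𝒳 → ℤ → ℝ → ℝ}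
    {ω : Ω} (hR : R ω ∈ Set.Icc (0 : ℝ) 1) (hU : U (X ω) (A ω) (R ω) ∈ Set.Icc (0 : ℝ) 1) :
    Rlow X A R U ω ∈ Set.Icc (0 : ℝ) 1 :=
  ⟨le_max_right _ _, max_le (by linarith [hR.2, hU.1]) zero_le_one⟩

lemma measurable_Gam {Ω 𝒳 𝒜 : Type*} [MeasurableSpace Ω] [MeasurableSpace 𝒳]
    [MeasurableSpace 𝒜] {X : Ω → 𝒳} {A : Ω → ℤ} {pr : ℤ → 𝒳 → ℝ}
    {ν : ℤ → 𝒳 → 𝒜 → ℝ} {Rl : Ω → ℝ} {a : ℤ} (hX : Measurable X) (hA : Measurable A)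
    (hpr : Measurable (pr a)) (hν : Measurable fun q : 𝒳 × 𝒜 => ν a q.1 q.2)
    (hRl : Measurable Rl) :
    Measurable fun q : 𝒜 × Ω => Gam X A pr ν Rl a q.1 q.2 := by
  have h1 : Measurable fun q : 𝒜 × Ω => ν a (X q.2) q.1 :=
    hν.comp ((hX.comp measurable_snd).prodMk measurable_fst)
  have h2 : Measurable fun q : 𝒜 × Ω => if A q.2 = a then (1 : ℝ) else 0 :=
    Measurable.ite (hA.comp measurable_snd (measurableSet_singleton a)) measurable_const
      measurable_const
  exact h1.add ((h2.div (hpr.comp (hX.comp measurable_snd))).mul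
    ((hRl.comp measurable_snd).sub h1))

/-- The doubly robust score with the correct propensity is unbiased for a potential outcome `Y`
on any event determined by the covariate. -/
lemma integral_indicator_mul_score {Ω : Type*} {m mΩ : MeasurableSpace Ω}
    [StandardBorelSpace Ω] (hm : m ≤ mΩ) {P : Measure Ω} [IsProbabilityMeasure P]
    {Y : Ω → ℝ} {A : Ω → ℤ} (hY : Measurable Y) (hA : Measurable A)
    (hY01 : ∀ ω, Y ω ∈ Set.Icc (0 : ℝ) 1)
    (hYA : CondIndepFun m hm Y A P) {a : ℤ} {p c g : Ω → ℝ} {ε : ℝ} (hε : 0 < ε)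
    (hp : P[(fun ω => if A ω = a then (1 : ℝ) else 0) | m] =ᵐ[P] p)
    (hpm : Measurable[m] p) (hpε : ∀ ω, ε ≤ p ω)
    (hc : Measurable[m] c) (hc01 : ∀ ω, c ω ∈ Set.Icc (0 : ℝ) 1)
    (hg : Measurable[m] g) (hg01 : ∀ ω, g ω ∈ Set.Icc (0 : ℝ) 1) :
    Integrable (fun ω => g ω * (c ω + (if A ω = a then (1 : ℝ) else 0) / p ω * (Y ω - c ω))) P ∧
    ∫ ω, g ω * (c ω + (if A ω = a then (1 : ℝ) else 0) / p ω * (Y ω - c ω)) ∂P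
      = ∫ ω, g ω * Y ω ∂P := by
  set I : Ω → ℝ := fun ω => if A ω = a then (1 : ℝ) else 0 with hI
  set h : Ω → ℝ := fun ω => g ω / p ω with hh
  have hp0 : ∀ ω, 0 < p ω := fun ω => hε.trans_le (hpε ω)
  have hhm : Measurable[m] h := hg.div hpm
  have hh0 : ∀ ω, 0 ≤ h ω := fun ω => div_nonneg (hg01 ω).1 (hp0 ω).le
  have hhC : ∀ ω, h ω ≤ ε⁻¹ := fun ω => by
    rw [← one_div]
    exact div_le_div₀ zero_le_one (hg01 ω).2 hε (hpε ω)
  have hhg : ∀ ω, h ω * p ω = g ω := fun ω => div_mul_cancel₀ _ (hp0 ω).ne'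
  have hIm : Measurable I :=
    Measurable.ite (hA (measurableSet_singleton a)) measurable_const measurable_const
  have hI01 : ∀ ω, I ω ∈ Set.Icc (0 : ℝ) 1 := fun ω => by
    simp only [hI]; split_ifs <;> simp
  have hIi : Integrable I P := Integrable.of_mem_Icc 0 1 hIm.aemeasurable
    (Filter.Eventually.of_forall hI01)
  have hi1 : Integrable (fun ω => g ω * c ω) P :=
    Integrable.of_mem_Icc 0 1 ((hg.mul hc).mono hm le_rfl).aemeasurable
      (Filter.Eventually.of_forall fun ω => ⟨mul_nonneg (hg01 ω).1 (hc01 ω).1,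
        mul_le_one₀ (hg01 ω).2 (hc01 ω).1 (hc01 ω).2⟩)
  have hhI : Integrable (fun ω => h ω * I ω) P :=
    hIi.bdd_mul (hhm.mono hm le_rfl).aestronglyMeasurable (c := ε⁻¹)
      (Filter.Eventually.of_forall fun ω => by rw [norm_of_nonneg (hh0 ω)]; exact hhC ω)
  have hi2 : Integrable (fun ω => h ω * I ω * Y ω) P :=
    hhI.mul_bdd (c := 1) hY.aestronglyMeasurable
      (Filter.Eventually.of_forall fun ω => by rw [norm_of_nonneg (hY01 ω).1]; exact (hY01 ω).2)
  have hi3 : Integrable (fun ω => h ω * c ω * I ω) P := by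
    have := hhI.mul_bdd (c := 1) (hc.mono hm le_rfl).aestronglyMeasurable
      (Filter.Eventually.of_forall fun ω => by rw [norm_of_nonneg (hc01 ω).1]; exact (hc01 ω).2)
    exact this.congr (Filter.Eventually.of_forall fun ω => by ring)
  have hdec : (fun ω => g ω * (c ω + I ω / p ω * (Y ω - c ω)))
      = fun ω => g ω * c ω + h ω * I ω * Y ω - h ω * c ω * I ω := by
    ext ω
    simp only [hh]
    ring
  have hY_eq : ∫ ω, h ω * I ω * Y ω ∂P = ∫ ω, g ω * Y ω ∂P :=
    integral_weight_mul_indicator_mul hm hY hA hYA hp hhm hh0 hhC hg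
      (fun ω => (hg01 ω).1) (fun ω => (hg01 ω).2) hhg
  have hc_eq : ∫ ω, h ω * c ω * I ω ∂P = ∫ ω, g ω * c ω ∂P := by
    have hhc : ∀ ω, |h ω * c ω| ≤ ε⁻¹ := fun ω => by
      rw [abs_of_nonneg (mul_nonneg (hh0 ω) (hc01 ω).1)]
      exact (mul_le_of_le_one_right (hh0 ω) (hc01 ω).2).trans (hhC ω)
    refine (integral_mul_condExp_of_bounded hm (hhm.mul hc) hhc hIi).symm.trans ?_
    refine integral_congr_ae ?_
    filter_upwards [hp] with ω hω
    rw [hω, ← hhg, Pi.mul_apply]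
    ring
  rw [hdec]
  refine ⟨(hi1.add hi2).sub hi3, ?_⟩
  rw [integral_sub (by exact hi1.add hi2) hi3, integral_add hi1 hi2, hY_eq, hc_eq]
  ring

lemma integrable_exp_of_abs_le {Θ : Type*} [MeasurableSpace Θ] {μ : Measure Θ} [IsFiniteMeasure μ]
    {g : Θ → ℝ} {C : ℝ} (hg : Measurable g) (hgC : ∀ θ, |g θ| ≤ C) :
    Integrable (fun θ => Real.exp (g θ)) μ :=
  Integrable.of_bound hg.exp.aestronglyMeasurable (Real.exp C)
    (Filter.Eventually.of_forall fun θ => by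
      rw [norm_of_nonneg (Real.exp_pos _).le]
      exact Real.exp_le_exp.2 ((le_abs_self _).trans (hgC θ)))

/-- **Donsker–Varadhan identity**: the tilted free energy gap is a Kullback–Leibler divergence. -/
lemma toReal_klDiv_tilted {Θ : Type*} [MeasurableSpace Θ] {Q Pri : Measure Θ}
    [IsProbabilityMeasure Q] [IsProbabilityMeasure Pri] {g : Θ → ℝ} {C : ℝ}
    (hg : Measurable g) (hgC : ∀ θ, |g θ| ≤ C) (hQ : Q ≪ Pri) (hllr : Integrable (llr Q Pri) Q) :
    (klDiv Q (Pri.tilted g)).toReal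
      = KLreal Q Pri - ∫ θ, g θ ∂Q + Real.log (∫ θ, Real.exp (g θ) ∂Pri) := by
  have hexp := integrable_exp_of_abs_le (μ := Pri) hg hgC
  have hgQ : Integrable g Q := Integrable.of_bound hg.aestronglyMeasurable C
    (Filter.Eventually.of_forall hgC)
  have := isProbabilityMeasure_tilted hexp
  rw [toReal_klDiv_of_measure_eq (hQ.trans (absolutelyContinuous_tilted hexp)) (by simp),
    integral_llr_tilted_right hQ hgQ hexp hllr, KLreal]

/-- Equality in the Donsker–Varadhan inequality only holds at the tilted measure. -/
lemma eq_tilted_of_toReal_klDiv_eq_zero {Θ : Type*} [MeasurableSpace Θ] {Q Pri : Measure Θ}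
    [IsProbabilityMeasure Q] [IsProbabilityMeasure Pri] {g : Θ → ℝ} {C : ℝ}
    (hg : Measurable g) (hgC : ∀ θ, |g θ| ≤ C) (hQ : Q ≪ Pri) (hllr : Integrable (llr Q Pri) Q)
    (h0 : (klDiv Q (Pri.tilted g)).toReal = 0) : Q = Pri.tilted g := by
  have hexp := integrable_exp_of_abs_le (μ := Pri) hg hgC
  have hgQ : Integrable g Q := Integrable.of_bound hg.aestronglyMeasurable C
    (Filter.Eventually.of_forall hgC)
  have := isProbabilityMeasure_tilted hexp
  rcases (ENNReal.toReal_eq_zero_iff _).1 h0 with h | h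
  · exact klDiv_eq_zero_iff.1 h
  · exact absurd h (klDiv_ne_top (hQ.trans (absolutelyContinuous_tilted hexp))
      (integrable_llr_tilted_right hQ hgQ hllr hexp))

lemma integrable_llr_tilted_self {Θ : Type*} [MeasurableSpace Θ] {Pri : Measure Θ}
    [IsProbabilityMeasure Pri] {g : Θ → ℝ} {C : ℝ}
    (hg : Measurable g) (hgC : ∀ θ, |g θ| ≤ C) :
    Integrable (llr (Pri.tilted g) Pri) (Pri.tilted g) := by
  have hexp := integrable_exp_of_abs_le (μ := Pri) hg hgC
  have := isProbabilityMeasure_tilted hexp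
  have hgT : Integrable g (Pri.tilted g) := Integrable.of_bound hg.aestronglyMeasurable C
    (Filter.Eventually.of_forall hgC)
  refine (hgT.sub (integrable_const (Real.log (∫ θ, Real.exp (g θ) ∂Pri)))).congr ?_
  filter_upwards [(tilted_absolutelyContinuous Pri g).ae_le (log_rnDeriv_tilted_left_self hexp)]
    with θ hθ
  exact hθ.symm

lemma tilted_add_const {Θ : Type*} [MeasurableSpace Θ] (μ : Measure Θ) (g : Θ → ℝ) (c : ℝ) :
    μ.tilted (fun θ => g θ + c) = μ.tilted g := by
  unfold Measure.tilted
  congr 1 with θ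
  simp_rw [Real.exp_add, integral_mul_const]
  rw [mul_div_mul_right _ _ (Real.exp_pos c).ne']

/-- **Hoeffding's lemma** for an i.i.d. sample of bounded scores whose mean is at most `v`. -/
lemma lintegral_exp_sum_le {Ω : Type*} [MeasurableSpace Ω] {P : Measure Ω}
    [IsProbabilityMeasure P] {G : Ω → ℝ} {lo hi v : ℝ} (hG : Measurable G)
    (hGI : ∀ ω, G ω ∈ Set.Icc lo hi) (hGv : ∫ ω, G ω ∂P ≤ v) (n : ℕ) {t : ℝ} (ht : 0 ≤ t) :
    ∫⁻ ωs : Fin n → Ω, ENNReal.ofReal (Real.exp (t * ∑ i, (G (ωs i) - v)))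
        ∂(Measure.pi fun _ => P)
      ≤ ENNReal.ofReal (Real.exp (n * (t ^ 2 * (hi - lo) ^ 2 / 8))) := by
  have hsub := hasSubgaussianMGF_of_mem_Icc (μ := P) hG.aemeasurable (Filter.Eventually.of_forall hGI)
  have hm := hsub.mgf_le t
  have hmgf : ∫ ω, Real.exp (t * (G ω - v)) ∂P ≤ Real.exp (t ^ 2 * (hi - lo) ^ 2 / 8) := by
    have h1 : ∫ ω, Real.exp (t * (G ω - v)) ∂P
        ≤ ∫ ω, Real.exp (t * (G ω - ∫ x, G x ∂P)) ∂P := by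
      refine integral_mono_of_nonneg (Filter.Eventually.of_forall fun _ => (Real.exp_pos _).le)
        (hsub.integrable_exp_mul t) (Filter.Eventually.of_forall fun ω => ?_)
      exact Real.exp_le_exp.2 (mul_le_mul_of_nonneg_left (by linarith) ht)
    refine h1.trans (hm.trans_eq ?_)
    congr 1
    push_cast
    rw [Real.norm_eq_abs, div_pow, sq_abs]
    ring
  have hprod : ∀ ωs : Fin n → Ω, Real.exp (t * ∑ i, (G (ωs i) - v))
      = ∏ i, Real.exp (t * (G (ωs i) - v)) := fun ωs => by
    rw [Finset.mul_sum, Real.exp_sum]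
  have hbdd : ∀ ωs : Fin n → Ω, t * ∑ i, (G (ωs i) - v) ≤ t * ∑ _i : Fin n, (hi - v) := fun ωs =>
    mul_le_mul_of_nonneg_left (Finset.sum_le_sum fun i _ => by linarith [(hGI (ωs i)).2]) ht
  have hmeas : Measurable fun ωs : Fin n → Ω => Real.exp (t * ∑ i, (G (ωs i) - v)) := by
    fun_prop
  have hint : Integrable (fun ωs : Fin n → Ω => Real.exp (t * ∑ i, (G (ωs i) - v)))
      (Measure.pi fun _ => P) :=
    Integrable.of_bound hmeas.aestronglyMeasurable (Real.exp (t * ∑ _i : Fin n, (hi - v)))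
      (Filter.Eventually.of_forall fun ωs => by
        rw [norm_of_nonneg (Real.exp_pos _).le]
        exact Real.exp_le_exp.2 (hbdd ωs))
  rw [← ofReal_integral_eq_lintegral_ofReal hint
    (Filter.Eventually.of_forall fun _ => (Real.exp_pos _).le)]
  refine ENNReal.ofReal_le_ofReal ?_
  simp_rw [hprod]
  rw [integral_fintype_prod_eq_pow (fun ω => Real.exp (t * (G ω - v))), Fintype.card_fin,
    Real.exp_nat_mul]
  exact pow_le_pow_left₀ (integral_nonneg fun _ => (Real.exp_pos _).le) hmgf n

/-- **PAC-Bayes lower bound** for bounded scores `G θ` whose mean is at most `v θ`. -/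
lemma pac_bayes_bounded_score {Ω Θ : Type*} [MeasurableSpace Ω] [MeasurableSpace Θ]
    {P : Measure Ω} [IsProbabilityMeasure P] {Pri : Measure Θ} [IsProbabilityMeasure Pri]
    {G : Θ → Ω → ℝ} {v : Θ → ℝ} {lo hi : ℝ} (hlohi : lo < hi)
    (hG : Measurable fun q : Θ × Ω => G q.1 q.2) (hGI : ∀ θ ω, G θ ω ∈ Set.Icc lo hi)
    (hv : Measurable v) (hv01 : ∀ θ, v θ ∈ Set.Icc (0 : ℝ) 1)
    (hGv : ∀ θ, ∫ ω, G θ ω ∂P ≤ v θ)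
    {n : ℕ} (hn : 0 < n) {δ : ℝ} (hδ : δ ∈ Set.Ioo (0 : ℝ) 1) {η : ℝ} (hη : 0 < η) :
    ENNReal.ofReal (1 - δ) ≤
      (Measure.pi fun _ : Fin n => P)
        {ωs | ∀ Q : Measure Θ, IsProbabilityMeasure Q → Q ≪ Pri → Integrable (llr Q Pri) Q →
          (∫ θ, (n : ℝ)⁻¹ * ∑ i, G θ (ωs i) ∂Q)
              - (hi - lo) * ((KLreal Q Pri + Real.log (1 / δ)) / (η * n) + η / 8)
            ≤ ∫ θ, v θ ∂Q} := by
  have hn' : (0 : ℝ) < n := Nat.cast_pos.2 hn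
  set K := hi - lo with hK
  have hK0 : 0 < K := sub_pos.2 hlohi
  set t := η / K with ht
  have ht0 : 0 < t := div_pos hη hK0
  set μ : Measure (Fin n → Ω) := Measure.pi fun _ : Fin n => P with hμ
  set g : (Fin n → Ω) → Θ → ℝ := fun ωs θ => t * ∑ i, (G θ (ωs i) - v θ) with hg
  have hgm : Measurable fun q : (Fin n → Ω) × Θ => g q.1 q.2 := by
    refine measurable_const.mul (Finset.measurable_sum _ fun i _ => ?_)
    refine Measurable.sub ?_ (hv.comp measurable_snd)
    exact hG.comp (measurable_snd.prodMk ((measurable_pi_apply i).comp measurable_fst))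
  have hgb : ∀ ωs θ, |g ωs θ| ≤ t * (n * (max |lo| |hi| + 1)) := by
    intro ωs θ
    rw [hg, abs_mul, abs_of_pos ht0]
    refine mul_le_mul_of_nonneg_left ((Finset.abs_sum_le_sum_abs _ _).trans ?_) ht0.le
    refine (Finset.sum_le_card_nsmul _ _ (max |lo| |hi| + 1) fun i _ => ?_).trans_eq (by simp [mul_add])
    refine (abs_sub _ _).trans (add_le_add ?_ ?_)
    · exact abs_le_max_abs_abs (hGI θ (ωs i)).1 (hGI θ (ωs i)).2
    · rw [abs_of_nonneg (hv01 θ).1]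
      exact (hv01 θ).2
  set M : (Fin n → Ω) → ENNReal := fun ωs => ∫⁻ θ, ENNReal.ofReal (Real.exp (g ωs θ)) ∂Pri with hM
  have hgE : Measurable fun q : (Fin n → Ω) × Θ => ENNReal.ofReal (Real.exp (g q.1 q.2)) :=
    hgm.exp.ennreal_ofReal
  have hMm : Measurable M := hgE.lintegral_prod_right'
  set c := Real.exp (n * (η ^ 2 / 8)) with hc
  have hc0 : 0 < c := Real.exp_pos _
  have hMle : ∫⁻ ωs, M ωs ∂μ ≤ ENNReal.ofReal c := by
    rw [hM, lintegral_lintegral_swap hgE.aemeasurable]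
    calc ∫⁻ θ, ∫⁻ ωs, ENNReal.ofReal (Real.exp (g ωs θ)) ∂μ ∂Pri
        ≤ ∫⁻ _θ, ENNReal.ofReal c ∂Pri := by
          refine lintegral_mono fun θ => ?_
          refine (lintegral_exp_sum_le (hG.comp measurable_prodMk_left) (hGI θ) (hGv θ) n
            ht0.le).trans_eq ?_
          rw [hc, ht, ← hK]
          field_simp
      _ = ENNReal.ofReal c := by simp
  have hbad : μ {ωs | ENNReal.ofReal (c / δ) ≤ M ωs} ≤ ENNReal.ofReal δ := by
    have h1 := (mul_meas_ge_le_lintegral (μ := μ) hMm (ENNReal.ofReal (c / δ))).trans hMle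
    have hcd : 0 < c / δ := div_pos hc0 hδ.1
    have h2 : ENNReal.ofReal c = ENNReal.ofReal (c / δ) * ENNReal.ofReal δ := by
      rw [← ENNReal.ofReal_mul hcd.le, div_mul_cancel₀ _ hδ.1.ne']
    rw [h2] at h1
    exact (ENNReal.mul_le_mul_iff_right (ENNReal.ofReal_pos.2 hcd).ne' ENNReal.ofReal_ne_top).1 h1
  have hgood : ENNReal.ofReal (1 - δ) ≤ μ {ωs | ENNReal.ofReal (c / δ) ≤ M ωs}ᶜ := by
    rw [prob_compl_eq_one_sub (measurableSet_le measurable_const hMm),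
      ENNReal.ofReal_sub _ hδ.1.le, ENNReal.ofReal_one]
    exact tsub_le_tsub_left hbad _
  refine hgood.trans (measure_mono fun ωs hωs Q hQp hQ hllr => ?_)
  have hgθ : Measurable (g ωs) := hgm.comp measurable_prodMk_left
  have hexp := integrable_exp_of_abs_le (μ := Pri) hgθ (hgb ωs)
  have hMlt : ∫ θ, Real.exp (g ωs θ) ∂Pri < c / δ := by
    have h1 : M ωs < ENNReal.ofReal (c / δ) := not_le.1 hωs
    simp only [hM] at h1
    rw [← ofReal_integral_eq_lintegral_ofReal hexp
      (Filter.Eventually.of_forall fun _ => (Real.exp_pos _).le)] at h1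
    exact (ENNReal.ofReal_lt_ofReal_iff (div_pos hc0 hδ.1)).1 h1
  have hlog : Real.log (∫ θ, Real.exp (g ωs θ) ∂Pri) ≤ n * (η ^ 2 / 8) + Real.log (1 / δ) := by
    refine (Real.log_le_log (integral_exp_pos hexp) hMlt.le).trans_eq ?_
    rw [div_eq_mul_one_div, Real.log_mul hc0.ne' (one_div_pos.2 hδ.1).ne', hc, Real.log_exp]
  have hDV := toReal_klDiv_tilted hgθ (hgb ωs) hQ hllr
  have hkl0 : 0 ≤ (klDiv Q (Pri.tilted (g ωs))).toReal := ENNReal.toReal_nonneg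
  have hvQ : Integrable v Q := Integrable.of_mem_Icc 0 1 hv.aemeasurable
    (Filter.Eventually.of_forall hv01)
  have hGQ : Integrable (fun θ => ∑ i, G θ (ωs i)) Q :=
    integrable_finsetSum _ fun i _ => Integrable.of_mem_Icc lo hi
      (hG.comp measurable_prodMk_right).aemeasurable
      (Filter.Eventually.of_forall fun θ => hGI θ (ωs i))
  have hgint : ∫ θ, g ωs θ ∂Q = t * ((∫ θ, ∑ i, G θ (ωs i) ∂Q) - n * ∫ θ, v θ ∂Q) := by
    simp only [hg, Finset.sum_sub_distrib, Finset.sum_const, Finset.card_univ, Fintype.card_fin,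
      nsmul_eq_mul]
    rw [integral_const_mul, integral_sub hGQ (hvQ.const_mul _), integral_const_mul]
  rw [integral_const_mul]
  set S := ∫ θ, ∑ i, G θ (ωs i) ∂Q
  set W := ∫ θ, v θ ∂Q
  have hmain : t * (S - n * W) ≤ KLreal Q Pri + Real.log (1 / δ) + n * (η ^ 2 / 8) := by
    linarith
  have hkey : (n : ℝ)⁻¹ * S - W
      ≤ K * ((KLreal Q Pri + Real.log (1 / δ)) / (η * n) + η / 8) := by
    have e1 : (n : ℝ)⁻¹ * S - W = K / (η * n) * (t * (S - n * W)) := by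
      rw [ht]; field_simp
    have e2 : K * ((KLreal Q Pri + Real.log (1 / δ)) / (η * n) + η / 8)
        = K / (η * n) * (KLreal Q Pri + Real.log (1 / δ) + n * (η ^ 2 / 8)) := by
      field_simp
    rw [e1, e2]
    exact mul_le_mul_of_nonneg_left hmain (by positivity)
  linarith

/-- Conservative validity of the certified score: its mean is at most the value of the rule
`sgn ∘ F` for potential outcomes `Y` dominating the certified reward. -/
lemma integral_Gam_le {Ω 𝒳 𝒜 : Type*} [MeasurableSpace Ω] [StandardBorelSpace Ω]
    [MeasurableSpace 𝒳] [MeasurableSpace 𝒜] {P : Measure Ω} [IsProbabilityMeasure P]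
    {X : Ω → 𝒳} (hX : Measurable X) {A : Ω → ℤ} (hA : Measurable A)
    {Rl : Ω → ℝ} (hRlm : Measurable Rl) (hRl01 : ∀ ω, Rl ω ∈ Set.Icc (0 : ℝ) 1)
    {Y : ℤ → Ω → ℝ} (hY : ∀ a, Measurable (Y a)) (hY01 : ∀ a ω, Y a ω ∈ Set.Icc (0 : ℝ) 1)
    (hRlY : ∀ a ∈ ({1, -1} : Set ℤ), ∀ᵐ ω ∂P, A ω = a → Rl ω ≤ Y a ω)
    (hYA : ∀ a ∈ ({1, -1} : Set ℤ),
      CondIndepFun (MeasurableSpace.comap X inferInstance) hX.comap_le (Y a) A P)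
    {pr : ℤ → 𝒳 → ℝ} (hpr : ∀ a, Measurable (pr a))
    (hprver : ∀ a ∈ ({1, -1} : Set ℤ),
      (P[(fun ω => if A ω = a then (1 : ℝ) else 0) |
          MeasurableSpace.comap X inferInstance]) =ᵐ[P] fun ω => pr a (X ω))
    {ε : ℝ} (hε : ε ∈ Set.Ioc (0 : ℝ) (1 / 2))
    (hprε : ∀ a ∈ ({1, -1} : Set ℤ), ∀ x, ε ≤ pr a x)
    {ν : ℤ → 𝒳 → 𝒜 → ℝ} (hν : ∀ a, Measurable fun q : 𝒳 × 𝒜 => ν a q.1 q.2)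
    (hν01 : ∀ a x α, ν a x α ∈ Set.Icc (0 : ℝ) 1)
    {F : 𝒳 → ℝ} (hF : Measurable F) (α : 𝒜) :
    ∫ ω, Gam X A pr ν Rl (if 0 ≤ F (X ω) then 1 else -1) α ω ∂P
      ≤ ∫ ω, Y (if 0 ≤ F (X ω) then 1 else -1) ω ∂P := by
  have h1mem : (1 : ℤ) ∈ ({1, -1} : Set ℤ) := by simp
  have h2mem : (-1 : ℤ) ∈ ({1, -1} : Set ℤ) := by simp
  have hFs : MeasurableSet {x | 0 ≤ F x} := measurableSet_le measurable_const hF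
  have hD : MeasurableSet {ω | 0 ≤ F (X ω)} := hX hFs
  set g₁ : 𝒳 → ℝ := fun x => if 0 ≤ F x then 1 else 0 with hg₁
  set g₂ : 𝒳 → ℝ := fun x => if 0 ≤ F x then 0 else 1 with hg₂
  have hg₁m : Measurable g₁ := Measurable.ite hFs measurable_const measurable_const
  have hg₂m : Measurable g₂ := Measurable.ite hFs measurable_const measurable_const
  have hg₁01 : ∀ x, g₁ x ∈ Set.Icc (0 : ℝ) 1 := fun x => by
    simp only [hg₁]; split_ifs <;> simp
  have hg₂01 : ∀ x, g₂ x ∈ Set.Icc (0 : ℝ) 1 := fun x => by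
    simp only [hg₂]; split_ifs <;> simp
  have hXm : Measurable[MeasurableSpace.comap X inferInstance] X := comap_measurable X
  have hscore : ∀ a ∈ ({1, -1} : Set ℤ), ∀ g : 𝒳 → ℝ, Measurable g →
      (∀ x, g x ∈ Set.Icc (0 : ℝ) 1) →
      Integrable (fun ω => g (X ω) * Gam X A pr ν (Y a) a α ω) P ∧
      ∫ ω, g (X ω) * Gam X A pr ν (Y a) a α ω ∂P = ∫ ω, g (X ω) * Y a ω ∂P :=
    fun a ha g hg hg01 => integral_indicator_mul_score hX.comap_le (hY a) hA (hY01 a) (hYA a ha)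
      hε.1 (hprver a ha) ((hpr a).comp hXm) (fun ω => hprε a ha (X ω))
      (((hν a).comp measurable_prodMk_right).comp hXm) (fun ω => hν01 a (X ω) α)
      (hg.comp hXm) (fun ω => hg01 (X ω))
  obtain ⟨hi₁, he₁⟩ := hscore 1 h1mem g₁ hg₁m hg₁01
  obtain ⟨hi₂, he₂⟩ := hscore (-1) h2mem g₂ hg₂m hg₂01
  have hmono : ∀ a ∈ ({1, -1} : Set ℤ), ∀ ω, (A ω = a → Rl ω ≤ Y a ω) →
      Gam X A pr ν Rl a α ω ≤ Gam X A pr ν (Y a) a α ω := by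
    intro a ha ω hω
    unfold Gam
    by_cases hAa : A ω = a
    · have : 0 ≤ (if A ω = a then (1 : ℝ) else 0) / pr a (X ω) :=
        div_nonneg (by simp [hAa]) (hε.1.le.trans (hprε a ha _))
      have := mul_le_mul_of_nonneg_left (sub_le_sub_right (hω hAa) (ν a (X ω) α)) this
      linarith
    · simp [hAa]
  have hYi : ∀ a, ∀ g : 𝒳 → ℝ, Measurable g → (∀ x, g x ∈ Set.Icc (0 : ℝ) 1) →
      Integrable (fun ω => g (X ω) * Y a ω) P := fun a g hg hg01 =>
    Integrable.of_mem_Icc 0 1 ((hg.comp hX).mul (hY a)).aemeasurable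
      (Filter.Eventually.of_forall fun ω => ⟨mul_nonneg (hg01 _).1 (hY01 a ω).1,
        mul_le_one₀ (hg01 _).2 (hY01 a ω).1 (hY01 a ω).2⟩)
  have hGm : ∀ a, Measurable fun ω => Gam X A pr ν Rl a α ω := fun a =>
    (measurable_Gam hX hA (hpr a) (hν a) hRlm).comp measurable_prodMk_left
  have hGi : Integrable (fun ω => Gam X A pr ν Rl (if 0 ≤ F (X ω) then 1 else -1) α ω) P := by
    refine Integrable.of_mem_Icc (1 - ε⁻¹) ε⁻¹ (Measurable.aemeasurable ?_)
      (Filter.Eventually.of_forall fun ω => Gam_mem_Icc hε (hprε _ ?_ _) (hν01 _ _ _) (hRl01 ω))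
    · have : (fun ω => Gam X A pr ν Rl (if 0 ≤ F (X ω) then 1 else -1) α ω)
          = fun ω => if 0 ≤ F (X ω) then Gam X A pr ν Rl 1 α ω else Gam X A pr ν Rl (-1) α ω := by
        ext ω
        split_ifs <;> rfl
      rw [this]
      exact Measurable.ite hD (hGm 1) (hGm (-1))
    · split_ifs <;> simp
  calc ∫ ω, Gam X A pr ν Rl (if 0 ≤ F (X ω) then 1 else -1) α ω ∂P
      ≤ ∫ ω, g₁ (X ω) * Gam X A pr ν (Y 1) 1 α ω + g₂ (X ω) * Gam X A pr ν (Y (-1)) (-1) α ω ∂P := by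
        refine integral_mono_ae hGi (hi₁.add hi₂) ?_
        filter_upwards [hRlY 1 h1mem, hRlY (-1) h2mem] with ω hω₁ hω₂
        by_cases hω : 0 ≤ F (X ω)
        · simpa [hg₁, hg₂, hω] using hmono 1 h1mem ω hω₁
        · simpa [hg₁, hg₂, hω] using hmono (-1) h2mem ω hω₂
    _ = ∫ ω, g₁ (X ω) * Y 1 ω + g₂ (X ω) * Y (-1) ω ∂P := by
        rw [integral_add hi₁ hi₂, he₁, he₂,
          integral_add (hYi 1 g₁ hg₁m hg₁01) (hYi (-1) g₂ hg₂m hg₂01)]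
    _ = ∫ ω, Y (if 0 ≤ F (X ω) then 1 else -1) ω ∂P := by
        congr 1 with ω
        by_cases hω : 0 ≤ F (X ω) <;> simp [hg₁, hg₂, hω]

/-- The PAC-Bayes objective is, up to constants, minus the divergence to the Gibbs posterior. -/
lemma pac_bayes_objective_eq {Θ : Type*} [MeasurableSpace Θ] {Q Pri : Measure Θ}
    [IsProbabilityMeasure Q] [IsProbabilityMeasure Pri] {V : Θ → ℝ} {C K η N L : ℝ}
    (hV : Measurable V) (hVC : ∀ θ, |η * N / K * V θ| ≤ C) (hK : 0 < K) (hη : 0 < η) (hN : 0 < N)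
    (hQ : Q ≪ Pri) (hllr : Integrable (llr Q Pri) Q) :
    (∫ θ, V θ ∂Q) - K * ((KLreal Q Pri + L) / (η * N) + η / 8)
      = K / (η * N) * (Real.log (∫ θ, Real.exp (η * N / K * V θ) ∂Pri)
          - (klDiv Q (Pri.tilted fun θ => η * N / K * V θ)).toReal - L) - K * (η / 8) := by
  rw [toReal_klDiv_tilted (hV.const_mul _) hVC hQ hllr, integral_const_mul]
  field_simp
  ring

/-- **PAC-Bayes lower bound and exact general Bayes update.** -/
theorem pac_bayes_lower_bound_and_general_bayes_update
    {Ω 𝒳 𝒜 ℬ : Type*} [MeasurableSpace Ω] [StandardBorelSpace Ω] [MeasurableSpace 𝒳]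
    [MeasurableSpace 𝒜] [MeasurableSpace ℬ]
    (P : Measure Ω) [IsProbabilityMeasure P]
    (X : Ω → 𝒳) (hX : Measurable X)
    (A : Ω → ℤ) (hA : Measurable A) (hA1 : ∀ ω, A ω = 1 ∨ A ω = -1)
    (R Rstar : Ω → ℝ) (hR : Measurable R) (hRstar : Measurable Rstar)
    (hR01 : ∀ ω, R ω ∈ Set.Icc (0 : ℝ) 1) (hRstar01 : ∀ ω, Rstar ω ∈ Set.Icc (0 : ℝ) 1)
    (Rpot Rstarpot : ℤ → Ω → ℝ)
    (hRpot : ∀ a, Measurable (Rpot a)) (hRstarpot : ∀ a, Measurable (Rstarpot a))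
    (hRpot01 : ∀ a ω, Rpot a ω ∈ Set.Icc (0 : ℝ) 1)
    (hRstarpot01 : ∀ a ω, Rstarpot a ω ∈ Set.Icc (0 : ℝ) 1)
    (hcons : ∀ a ∈ ({1, -1} : Set ℤ),
      ∀ᵐ ω ∂P, A ω = a → R ω = Rpot a ω ∧ Rstar ω = Rstarpot a ω)
    (hignor : CondIndepFun (MeasurableSpace.comap X inferInstance) hX.comap_le
      (fun ω => (Rpot 1 ω, Rpot (-1) ω, Rstarpot 1 ω, Rstarpot (-1) ω)) A P)
    (pr : ℤ → 𝒳 → ℝ) (hpr : ∀ a, Measurable (pr a))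
    (hprver : ∀ a ∈ ({1, -1} : Set ℤ),
      (P[(fun ω => if A ω = a then (1 : ℝ) else 0) |
          MeasurableSpace.comap X inferInstance]) =ᵐ[P] fun ω => pr a (X ω))
    (ε : ℝ) (hε : ε ∈ Set.Ioc (0 : ℝ) (1 / 2))
    (hprε : ∀ a ∈ ({1, -1} : Set ℤ), ∀ x, ε ≤ pr a x)
    -- one-sided reward certificate
    (U : 𝒳 → ℤ → ℝ → ℝ)
    (hU : Measurable fun q : 𝒳 × ℤ × ℝ => U q.1 q.2.1 q.2.2)
    (hU01 : ∀ x a r, U x a r ∈ Set.Icc (0 : ℝ) 1)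
    (hcert : ∀ᵐ ω ∂P, R ω - U (X ω) (A ω) (R ω) ≤ Rstar ω)
    -- nuisances and policy scores
    (ν : ℤ → 𝒳 → 𝒜 → ℝ)
    (hν : ∀ a, Measurable fun q : 𝒳 × 𝒜 => ν a q.1 q.2)
    (hν01 : ∀ a x α, ν a x α ∈ Set.Icc (0 : ℝ) 1)
    (f : 𝒳 → ℬ → ℝ) (hf : Measurable fun q : 𝒳 × ℬ => f q.1 q.2)
    -- prior, sample size, confidence level and learning rate
    (Pri : Measure (ℬ × 𝒜)) [IsProbabilityMeasure Pri]
    (n : ℕ) (hn : 0 < n) (δ : ℝ) (hδ : δ ∈ Set.Ioo (0 : ℝ) 1) (η : ℝ) (hη : 0 < η) :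
    -- with probability at least 1 − δ over the i.i.d. sample, simultaneously for all
    -- posteriors `Q ≪ Pri`:
    ENNReal.ofReal (1 - δ) ≤
      (Measure.pi fun _ : Fin n => P)
        {ωs | ∀ Q : Measure (ℬ × 𝒜), IsProbabilityMeasure Q → Q ≪ Pri →
          Integrable (llr Q Pri) Q →
          (∫ θ, Vhat X A pr ν (Rlow X A R U) f n θ ωs ∂Q)
              - (2 * ε⁻¹ - 1) * ((KLreal Q Pri + Real.log (1 / δ)) / (η * n) + η / 8)
            ≤ ∫ θ, (∫ ω, Rstarpot (if 0 ≤ f (X ω) θ.1 then 1 else -1) ω ∂P) ∂Q} ∧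
    -- for fixed `η`, the right-hand side is uniquely maximized by the Gibbs posterior,
    -- which is exactly the general Bayes update for the certified value loss
    (∀ ωs : Fin n → Ω,
      IsProbabilityMeasure
        (Pri.tilted fun θ =>
          η * n / (2 * ε⁻¹ - 1) * Vhat X A pr ν (Rlow X A R U) f n θ ωs) ∧
      (Pri.tilted fun θ =>
          η * n / (2 * ε⁻¹ - 1) * Vhat X A pr ν (Rlow X A R U) f n θ ωs) ≪ Pri ∧
      Integrable
        (llr (Pri.tilted fun θ =>
            η * n / (2 * ε⁻¹ - 1) * Vhat X A pr ν (Rlow X A R U) f n θ ωs) Pri)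
        (Pri.tilted fun θ =>
            η * n / (2 * ε⁻¹ - 1) * Vhat X A pr ν (Rlow X A R U) f n θ ωs) ∧
      -- equality of the two Gibbs forms
      (Pri.tilted fun θ =>
          η * n / (2 * ε⁻¹ - 1) * Vhat X A pr ν (Rlow X A R U) f n θ ωs)
        = (Pri.tilted fun θ => -η * ∑ i,
            (ε⁻¹ - Gam X A pr ν (Rlow X A R U)
                (if 0 ≤ f (X (ωs i)) θ.1 then 1 else -1) θ.2 (ωs i))
              / (2 * ε⁻¹ - 1)) ∧
      (∀ Q : Measure (ℬ × 𝒜), IsProbabilityMeasure Q → Q ≪ Pri →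
        Integrable (llr Q Pri) Q →
        ((∫ θ, Vhat X A pr ν (Rlow X A R U) f n θ ωs ∂Q)
            - (2 * ε⁻¹ - 1) * ((KLreal Q Pri + Real.log (1 / δ)) / (η * n) + η / 8)
          ≤ (∫ θ, Vhat X A pr ν (Rlow X A R U) f n θ ωs
                ∂(Pri.tilted fun θ =>
                  η * n / (2 * ε⁻¹ - 1) * Vhat X A pr ν (Rlow X A R U) f n θ ωs))
            - (2 * ε⁻¹ - 1) *
              ((KLreal (Pri.tilted fun θ =>
                    η * n / (2 * ε⁻¹ - 1) * Vhat X A pr ν (Rlow X A R U) f n θ ωs) Pri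
                  + Real.log (1 / δ)) / (η * n) + η / 8)) ∧
        (((∫ θ, Vhat X A pr ν (Rlow X A R U) f n θ ωs ∂Q)
            - (2 * ε⁻¹ - 1) * ((KLreal Q Pri + Real.log (1 / δ)) / (η * n) + η / 8)
          = (∫ θ, Vhat X A pr ν (Rlow X A R U) f n θ ωs
                ∂(Pri.tilted fun θ =>
                  η * n / (2 * ε⁻¹ - 1) * Vhat X A pr ν (Rlow X A R U) f n θ ωs))
            - (2 * ε⁻¹ - 1) *
              ((KLreal (Pri.tilted fun θ =>
                    η * n / (2 * ε⁻¹ - 1) * Vhat X A pr ν (Rlow X A R U) f n θ ωs) Pri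
                  + Real.log (1 / δ)) / (η * n) + η / 8)) →
          Q = Pri.tilted fun θ =>
            η * n / (2 * ε⁻¹ - 1) * Vhat X A pr ν (Rlow X A R U) f n θ ωs))) := by
  have hn' : (0 : ℝ) < n := Nat.cast_pos.2 hn
  have hε1 : 1 ≤ ε⁻¹ := (one_le_inv₀ hε.1).2 (by linarith [hε.2])
  have hK0 : 0 < 2 * ε⁻¹ - 1 := by linarith
  have hRlm : Measurable (Rlow X A R U) :=
    (hR.sub (hU.comp (hX.prodMk (hA.prodMk hR)))).max measurable_const
  have hRl01 : ∀ ω, Rlow X A R U ω ∈ Set.Icc (0 : ℝ) 1 := fun ω =>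
    Rlow_mem_Icc (hR01 ω) (hU01 _ _ _)
  have hRlY : ∀ a ∈ ({1, -1} : Set ℤ), ∀ᵐ ω ∂P, A ω = a → Rlow X A R U ω ≤ Rstarpot a ω := by
    intro a ha
    filter_upwards [hcons a ha, hcert] with ω h1 h2 hAa
    rw [← (h1 hAa).2]
    exact max_le h2 (hRstar01 ω).1
  have hYA : ∀ a ∈ ({1, -1} : Set ℤ),
      CondIndepFun (MeasurableSpace.comap X inferInstance) hX.comap_le (Rstarpot a) A P := by
    rintro a (rfl | rfl)
    · exact hignor.comp (φ := fun q : ℝ × ℝ × ℝ × ℝ => q.2.2.1) (ψ := id) (by fun_prop)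
        measurable_id
    · exact hignor.comp (φ := fun q : ℝ × ℝ × ℝ × ℝ => q.2.2.2) (ψ := id) (by fun_prop)
        measurable_id
  set G : ℬ × 𝒜 → Ω → ℝ := fun θ ω =>
    Gam X A pr ν (Rlow X A R U) (if 0 ≤ f (X ω) θ.1 then 1 else -1) θ.2 ω with hG
  have hfX : Measurable fun q : (ℬ × 𝒜) × Ω => f (X q.2) q.1.1 :=
    hf.comp ((hX.comp measurable_snd).prodMk (measurable_fst.comp measurable_fst))
  have hDs : MeasurableSet {q : (ℬ × 𝒜) × Ω | 0 ≤ f (X q.2) q.1.1} :=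
    measurableSet_le measurable_const hfX
  have hGm : Measurable fun q : (ℬ × 𝒜) × Ω => G q.1 q.2 := by
    have h1 : ∀ a, Measurable fun q : (ℬ × 𝒜) × Ω =>
        Gam X A pr ν (Rlow X A R U) a q.1.2 q.2 := fun a =>
      (measurable_Gam hX hA (hpr a) (hν a) hRlm).comp
        ((measurable_snd.comp measurable_fst).prodMk measurable_snd)
    have h2 : (fun q : (ℬ × 𝒜) × Ω => G q.1 q.2) = fun q => if 0 ≤ f (X q.2) q.1.1 then
        Gam X A pr ν (Rlow X A R U) 1 q.1.2 q.2 else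
        Gam X A pr ν (Rlow X A R U) (-1) q.1.2 q.2 := by
      ext q
      simp only [hG]
      split_ifs <;> rfl
    rw [h2]
    exact Measurable.ite hDs (h1 1) (h1 (-1))
  have hGI : ∀ θ ω, G θ ω ∈ Set.Icc (1 - ε⁻¹) ε⁻¹ := fun θ ω =>
    Gam_mem_Icc hε (hprε _ (by split_ifs <;> simp) _) (hν01 _ _ _) (hRl01 ω)
  constructor
  · set v : ℬ × 𝒜 → ℝ := fun θ => ∫ ω, Rstarpot (if 0 ≤ f (X ω) θ.1 then 1 else -1) ω ∂P with hv
    have hYm : Measurable fun q : (ℬ × 𝒜) × Ω =>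
        Rstarpot (if 0 ≤ f (X q.2) q.1.1 then 1 else -1) q.2 := by
      have h2 : (fun q : (ℬ × 𝒜) × Ω => Rstarpot (if 0 ≤ f (X q.2) q.1.1 then 1 else -1) q.2)
          = fun q => if 0 ≤ f (X q.2) q.1.1 then Rstarpot 1 q.2 else Rstarpot (-1) q.2 := by
        ext q
        split_ifs <;> rfl
      rw [h2]
      exact Measurable.ite hDs ((hRstarpot 1).comp measurable_snd)
        ((hRstarpot (-1)).comp measurable_snd)
    have hvm : Measurable v := (hYm.stronglyMeasurable.integral_prod_right').measurable
    have hv01 : ∀ θ, v θ ∈ Set.Icc (0 : ℝ) 1 := fun θ => by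
      refine ⟨integral_nonneg fun ω => (hRstarpot01 _ ω).1, ?_⟩
      have hle := integral_mono (μ := P)
        (Integrable.of_mem_Icc 0 1 (hYm.comp (measurable_prodMk_left (x := θ))).aemeasurable
          (Filter.Eventually.of_forall fun ω => hRstarpot01 _ ω))
        (integrable_const (1 : ℝ)) (fun ω => (hRstarpot01 _ ω).2)
      simpa using hle
    have hGv : ∀ θ, ∫ ω, G θ ω ∂P ≤ v θ := fun θ =>
      integral_Gam_le hX hA hRlm hRl01 hRstarpot hRstarpot01 hRlY hYA hpr hprver hε hprε hν hν01
        (hf.comp measurable_prodMk_right) θ.2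
    have hmain := pac_bayes_bounded_score (Pri := Pri) (by linarith : 1 - ε⁻¹ < ε⁻¹) hGm hGI hvm
      hv01 hGv hn hδ hη
    rwa [show ε⁻¹ - (1 - ε⁻¹) = 2 * ε⁻¹ - 1 by ring] at hmain
  · intro ωs
    set V : ℬ × 𝒜 → ℝ := fun θ => Vhat X A pr ν (Rlow X A R U) f n θ ωs with hV
    set g : ℬ × 𝒜 → ℝ := fun θ => η * n / (2 * ε⁻¹ - 1) * V θ with hg
    have hVm : Measurable V := measurable_const.mul
      (Finset.measurable_sum _ fun i _ => hGm.comp measurable_prodMk_right)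
    have hVb : ∀ θ, |V θ| ≤ (n : ℝ)⁻¹ * (n * ε⁻¹) := fun θ => by
      change |(n : ℝ)⁻¹ * ∑ i, G θ (ωs i)| ≤ _
      rw [abs_mul, abs_of_pos (inv_pos.2 hn')]
      refine mul_le_mul_of_nonneg_left ((Finset.abs_sum_le_sum_abs _ _).trans ?_)
        (inv_pos.2 hn').le
      refine (Finset.sum_le_card_nsmul _ _ ε⁻¹ fun i _ => ?_).trans_eq (by simp)
      exact abs_le.2 ⟨by linarith [(hGI θ (ωs i)).1], (hGI θ (ωs i)).2⟩
    have hgm : Measurable g := measurable_const.mul hVm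
    have hgb : ∀ θ, |g θ| ≤ |η * n / (2 * ε⁻¹ - 1)| * ((n : ℝ)⁻¹ * (n * ε⁻¹)) := fun θ => by
      simp only [hg]
      rw [abs_mul]
      exact mul_le_mul_of_nonneg_left (hVb θ) (abs_nonneg _)
    have hprob : IsProbabilityMeasure (Pri.tilted g) :=
      isProbabilityMeasure_tilted (integrable_exp_of_abs_le hgm hgb)
    have hac := tilted_absolutelyContinuous Pri g
    have hllrT := integrable_llr_tilted_self (Pri := Pri) hgm hgb
    refine ⟨hprob, hac, hllrT, ?_, fun Q hQp hQ hllr => ?_⟩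
    · rw [← tilted_add_const Pri g (-η * (n * ε⁻¹ / (2 * ε⁻¹ - 1)))]
      congr 1 with θ
      change η * n / (2 * ε⁻¹ - 1) * ((n : ℝ)⁻¹ * ∑ i, G θ (ωs i)) + _
        = -η * ∑ i, (ε⁻¹ - G θ (ωs i)) / (2 * ε⁻¹ - 1)
      rw [← Finset.sum_div, Finset.sum_sub_distrib]
      simp only [Finset.sum_const, Finset.card_univ, Fintype.card_fin, nsmul_eq_mul]
      field_simp
      ring
    · have hQeq := pac_bayes_objective_eq (L := Real.log (1 / δ)) hVm hgb hK0 hη hn' hQ hllr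
      have hTeq := pac_bayes_objective_eq (L := Real.log (1 / δ)) hVm hgb hK0 hη hn' hac hllrT
      rw [hQeq, hTeq, klDiv_self]
      have hcoef : 0 < (2 * ε⁻¹ - 1) / (η * n) := by positivity
      refine ⟨sub_le_sub_right (mul_le_mul_of_nonneg_left ?_ hcoef.le) _, fun heq => ?_⟩
      · simp
      · have h1 := mul_left_cancel₀ hcoef.ne' (sub_left_injective heq)
        rw [ENNReal.toReal_zero] at h1
        exact eq_tilted_of_toReal_klDiv_eq_zero hgm hgb hQ hllr (by linarith)
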